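/- For every E-linear code C of length n, the double dual satisfies (C^⊥)^⊥ = C. -/

import Mathlib

open scoped BigOperators

/-- The non-unital ring `E` of order 4: the pair `(u, v)` represents `uκ + vζ`,
where `ζ = κ + τ`.  Multiplication: `(uκ + vζ)·(u'κ + v'ζ) = u'·(uκ + vζ)`. -/
def RingE : Type := ZMod 2 × ZMod 2

namespace RingE

instance : AddCommGroup RingE := inferInstanceAs (AddCommGroup (ZMod 2 × ZMod 2))

instance : Mul RingE := ⟨fun a b => Prod.mk (Prod.fst a * Prod.fst b) (Prod.snd a * Prod.fst b)⟩

noncomputable instance : DecidableEq RingE := Classical.decEq _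

instance : NonUnitalRing RingE where
  left_distrib a b c := by
    show Prod.mk (Prod.fst a * (Prod.fst b + Prod.fst c))
        (Prod.snd a * (Prod.fst b + Prod.fst c)) = _
    show _ = Prod.mk (Prod.fst a * Prod.fst b + Prod.fst a * Prod.fst c)
        (Prod.snd a * Prod.fst b + Prod.snd a * Prod.fst c)
    simp [mul_add]
  right_distrib a b c := by
    show Prod.mk ((Prod.fst a + Prod.fst b) * Prod.fst c)
        ((Prod.snd a + Prod.snd b) * Prod.fst c) = _
    show _ = Prod.mk (Prod.fst a * Prod.fst c + Prod.fst b * Prod.fst c)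
        (Prod.snd a * Prod.fst c + Prod.snd b * Prod.fst c)
    simp [add_mul]
  zero_mul a := by
    show Prod.mk ((0 : ZMod 2) * Prod.fst a) ((0 : ZMod 2) * Prod.fst a) = ((0 : ZMod 2), (0 : ZMod 2))
    simp
  mul_zero a := by
    show Prod.mk (Prod.fst a * (0 : ZMod 2)) (Prod.snd a * (0 : ZMod 2)) = ((0 : ZMod 2), (0 : ZMod 2))
    simp
  mul_assoc a b c := by
    show Prod.mk (Prod.fst a * Prod.fst b * Prod.fst c) (Prod.snd a * Prod.fst b * Prod.fst c)
      = Prod.mk (Prod.fst a * (Prod.fst b * Prod.fst c)) (Prod.snd a * (Prod.fst b * Prod.fst c))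
    simp [mul_assoc]

/-- The generator `κ`. -/
def kappa : RingE := Prod.mk 1 0

/-- The generator `τ`. -/
def tau : RingE := Prod.mk 1 1

/-- `ζ = κ + τ`. -/
def zeta : RingE := Prod.mk 0 1

/-- The reduction map `π : E → F₂`, sending `uκ + vζ` to `u`. -/
def pi (a : RingE) : ZMod 2 := Prod.fst a

/-- `κ·c` for a scalar `c ∈ F₂`, i.e. the element `cκ` of `E`. -/
def kappaSMul (c : ZMod 2) : RingE := Prod.mk c 0

/-- `ζ·c` for a scalar `c ∈ F₂`, i.e. the element `cζ` of `E`. -/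
def zetaSMul (c : ZMod 2) : RingE := Prod.mk 0 c

end RingE

namespace ECode

/-- Componentwise reduction `π : Eⁿ → F₂ⁿ`. -/
def piVec {n : ℕ} (x : Fin n → RingE) : Fin n → ZMod 2 := fun i => RingE.pi (x i)

/-- The vector `κv ∈ Eⁿ` attached to `v ∈ F₂ⁿ`. -/
def kappaVec {n : ℕ} (v : Fin n → ZMod 2) : Fin n → RingE := fun i => RingE.kappaSMul (v i)

/-- The vector `ζv ∈ Eⁿ` attached to `v ∈ F₂ⁿ`. -/
def zetaVec {n : ℕ} (v : Fin n → ZMod 2) : Fin n → RingE := fun i => RingE.zetaSMul (v i)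

/-- An `E`-linear code of length `n`: a left `E`-submodule of `Eⁿ`, i.e. an additive
subgroup closed under componentwise left multiplication by elements of `E`. -/
def IsECode {n : ℕ} (C : Set (Fin n → RingE)) : Prop :=
  (0 : Fin n → RingE) ∈ C ∧ (∀ x ∈ C, ∀ y ∈ C, x + y ∈ C) ∧ (∀ x ∈ C, -x ∈ C) ∧
    ∀ (a : RingE), ∀ x ∈ C, (fun i => a * x i) ∈ C

/-- The residue code `C_Res = π(C)`. -/
def Res {n : ℕ} (C : Set (Fin n → RingE)) : Set (Fin n → ZMod 2) := piVec '' C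

/-- The torsion code `C_Tor = {v ∈ F₂ⁿ : ζv ∈ C}`. -/
def Tor {n : ℕ} (C : Set (Fin n → RingE)) : Set (Fin n → ZMod 2) := {v | zetaVec v ∈ C}

/-- A code is free if its residue and torsion codes coincide. -/
def IsFree {n : ℕ} (C : Set (Fin n → RingE)) : Prop := Res C = Tor C

/-- The inner product on `Eⁿ`. -/
def Einner {n : ℕ} (w z : Fin n → RingE) : RingE := ∑ i, w i * z i

/-- The left dual `C^{⊥L}`. -/
def dualL {n : ℕ} (C : Set (Fin n → RingE)) : Set (Fin n → RingE) :=
  {z | ∀ w ∈ C, Einner z w = 0}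

/-- The right dual `C^{⊥R}`. -/
def dualR {n : ℕ} (C : Set (Fin n → RingE)) : Set (Fin n → RingE) :=
  {z | ∀ w ∈ C, Einner w z = 0}

/-- The (two-sided) dual `C^⊥ = C^{⊥L} ∩ C^{⊥R}`. -/
def dualE {n : ℕ} (C : Set (Fin n → RingE)) : Set (Fin n → RingE) := dualL C ∩ dualR C

/-- The left hull `LHull(C) = C ∩ C^{⊥L}`. -/
def LHull {n : ℕ} (C : Set (Fin n → RingE)) : Set (Fin n → RingE) := C ∩ dualL C

/-- The right hull `RHull(C) = C ∩ C^{⊥R}`. -/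
def RHull {n : ℕ} (C : Set (Fin n → RingE)) : Set (Fin n → RingE) := C ∩ dualR C

/-- The hull `Hull(C) = C ∩ C^⊥`. -/
def EHull {n : ℕ} (C : Set (Fin n → RingE)) : Set (Fin n → RingE) := C ∩ dualE C

/-- The Euclidean inner product on `F₂ⁿ`. -/
def Finner {n : ℕ} (w z : Fin n → ZMod 2) : ZMod 2 := ∑ i, w i * z i

/-- The Euclidean dual of an `F₂`-linear code. -/
def dualF {n : ℕ} (B : Set (Fin n → ZMod 2)) : Set (Fin n → ZMod 2) :=
  {z | ∀ w ∈ B, Finner w z = 0}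

/-- The hull of an `F₂`-linear code. -/
def FHull {n : ℕ} (B : Set (Fin n → ZMod 2)) : Set (Fin n → ZMod 2) := B ∩ dualF B

/-- `F₂`-dimension of an `F₂`-linear code (as the dimension of its span). -/
noncomputable def dimF {n : ℕ} (B : Set (Fin n → ZMod 2)) : ℕ :=
  Module.finrank (ZMod 2) (Submodule.span (ZMod 2) B)

/-- Scalar multiplication of a vector of `Eⁿ` by `a ∈ E`. -/
def smulVec {n : ℕ} (a : RingE) (x : Fin n → RingE) : Fin n → RingE := fun i => a * x i

/-- The left `E`-span `⟨X⟩_E` of a finite set `X ⊆ Eⁿ`. -/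
def spanE {n : ℕ} (X : Finset (Fin n → RingE)) : Set (Fin n → RingE) :=
  {y | ∃ c : (Fin n → RingE) → RingE, y = ∑ x ∈ X, smulVec (c x) x}

/-- The additive (`F₂`-) span `⟨X⟩_{F₂}` of a finite set `X ⊆ Eⁿ`: all sums of subsets. -/
def spanF {n : ℕ} (X : Finset (Fin n → RingE)) : Set (Fin n → RingE) :=
  {y | ∃ S : Finset (Fin n → RingE), S ⊆ X ∧ y = ∑ x ∈ S, x}

/-- `X` is a generating set of the code `D` if `⟨X⟩_E ∪ ⟨X⟩_{F₂} = D`. -/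
def IsGenSet {n : ℕ} (X : Finset (Fin n → RingE)) (D : Set (Fin n → RingE)) : Prop :=
  spanE X ∪ spanF X = D

/-- The rank of a (free) code: the minimum cardinality of a generating set. -/
noncomputable def genRank {n : ℕ} (D : Set (Fin n → RingE)) : ℕ :=
  sInf {m | ∃ X : Finset (Fin n → RingE), X.card = m ∧ IsGenSet X D}

/-- Prepending two coordinates to a vector of length `n`. -/
def cons2 {n : ℕ} (a b : RingE) (x : Fin n → RingE) : Fin (n + 2) → RingE :=
  Fin.cons a (Fin.cons b x)

end ECode

namespace ECode

/-- Separation: a vector orthogonal to the dual of an additively closed `B` lies in `B`. -/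
theorem mem_of_dual {n : ℕ} (B : Set (Fin n → ZMod 2)) (h0 : (0 : Fin n → ZMod 2) ∈ B)
    (hadd : ∀ x ∈ B, ∀ y ∈ B, x + y ∈ B) (x : Fin n → ZMod 2)
    (hx : ∀ z : Fin n → ZMod 2, (∀ w ∈ B, ∑ i, z i * w i = 0) → ∑ i, z i * x i = 0) :
    x ∈ B := by
  let p : Submodule (ZMod 2) (Fin n → ZMod 2) :=
    { carrier := B
      zero_mem' := h0
      add_mem' := fun {a b} ha hb => hadd a ha b hb
      smul_mem' := by
        intro c y hy
        have hc : c = 0 ∨ c = 1 := by revert c; decide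
        rcases hc with rfl | rfl
        · simpa using h0
        · simpa using hy }
  by_contra hne
  have hxp : x ∉ p := hne
  obtain ⟨f, hf, hp⟩ := Submodule.exists_le_ker_of_notMem hxp
  have key : ∀ y, ∑ i, f (Pi.single i 1) * y i = f y := by
    intro y
    rw [LinearMap.pi_apply_eq_sum_univ f y]
    refine Finset.sum_congr rfl fun i _ => ?_
    rw [smul_eq_mul, mul_comm]
    congr 2
    funext j
    simp [Pi.single_apply, eq_comm]
  apply hf
  rw [← key]
  apply hx
  intro w hw
  rw [key]
  exact hp hw

theorem fst_sum {n : ℕ} (f : Fin n → RingE) : Prod.fst (∑ i, f i) = ∑ i, Prod.fst (f i) :=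
  Prod.fst_sum (M := ZMod 2) (N := ZMod 2) (s := Finset.univ) (f := f)

theorem snd_sum {n : ℕ} (f : Fin n → RingE) : Prod.snd (∑ i, f i) = ∑ i, Prod.snd (f i) :=
  Prod.snd_sum (M := ZMod 2) (N := ZMod 2) (s := Finset.univ) (f := f)

theorem Einner_eq_zero {n : ℕ} (w z : Fin n → RingE) : Einner w z = 0 ↔
    ∑ i, Prod.fst (w i) * Prod.fst (z i) = 0 ∧ ∑ i, Prod.snd (w i) * Prod.fst (z i) = 0 := by
  have h1 : Prod.fst (Einner w z) = ∑ i, Prod.fst (w i) * Prod.fst (z i) := fst_sum _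
  have h2 : Prod.snd (Einner w z) = ∑ i, Prod.snd (w i) * Prod.fst (z i) := snd_sum _
  rw [← h1, ← h2]
  exact Prod.ext_iff (α := ZMod 2) (β := ZMod 2)

theorem kappaVec_mem {n : ℕ} {C : Set (Fin n → RingE)} (hC : IsECode C) {x : Fin n → RingE}
    (hx : x ∈ C) : kappaVec (piVec x) ∈ C := by
  have h := hC.2.2.2 RingE.kappa x hx
  have e : (fun i => RingE.kappa * x i) = kappaVec (piVec x) := by
    funext i
    show Prod.mk ((1 : ZMod 2) * Prod.fst (x i)) ((0 : ZMod 2) * Prod.fst (x i)) =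
      Prod.mk (Prod.fst (x i)) (0 : ZMod 2)
    simp
  rwa [e] at h

theorem zetaVec_mem {n : ℕ} {C : Set (Fin n → RingE)} (hC : IsECode C) {x : Fin n → RingE}
    (hx : x ∈ C) : zetaVec (piVec x) ∈ C := by
  have h := hC.2.2.2 RingE.zeta x hx
  have e : (fun i => RingE.zeta * x i) = zetaVec (piVec x) := by
    funext i
    show Prod.mk ((0 : ZMod 2) * Prod.fst (x i)) ((1 : ZMod 2) * Prod.fst (x i)) =
      Prod.mk (0 : ZMod 2) (Prod.fst (x i))
    simp
  rwa [e] at h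

theorem decomp {n : ℕ} (x : Fin n → RingE) :
    kappaVec (piVec x) + zetaVec (fun i => Prod.snd (x i)) = x := by
  funext i
  show Prod.mk (Prod.fst (x i) + (0 : ZMod 2)) ((0 : ZMod 2) + Prod.snd (x i)) = x i
  rw [add_zero, zero_add]
  rfl

theorem zetaVec_snd_mem {n : ℕ} {C : Set (Fin n → RingE)} (hC : IsECode C) {x : Fin n → RingE}
    (hx : x ∈ C) : zetaVec (fun i => Prod.snd (x i)) ∈ C := by
  have h := hC.2.1 _ (hC.2.2.1 _ (kappaVec_mem hC hx)) _ hx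
  have e : -kappaVec (piVec x) + x = zetaVec (fun i => Prod.snd (x i)) := by
    conv_lhs => rw [← decomp x]
    rw [show piVec (kappaVec (piVec x) + zetaVec (fun i => Prod.snd (x i))) = piVec x by
      rw [decomp x]]
    exact neg_add_cancel_left _ _
  rwa [e] at h

end ECode

open ECode in
/-- For every `E`-linear code `C`, `(C^⊥)^⊥ = C`. -/
theorem double_dual {n : ℕ} (C : Set (Fin n → RingE)) (hC : IsECode C) :
    dualE (dualE C) = C := by
  apply Set.Subset.antisymm
  · rintro x ⟨hL, hR⟩
    have ha : piVec x ∈ Res C := by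
      apply mem_of_dual
      · exact ⟨0, hC.1, rfl⟩
      · rintro _ ⟨y, hy, rfl⟩ _ ⟨z, hz, rfl⟩
        exact ⟨y + z, hC.2.1 y hy z hz, rfl⟩
      · intro d hd
        have hm : zetaVec d ∈ dualE C := by
          constructor
          · intro w hw
            rw [Einner_eq_zero]
            refine ⟨Finset.sum_eq_zero fun i _ => zero_mul _, hd _ ⟨w, hw, rfl⟩⟩
          · intro w hw
            rw [Einner_eq_zero]
            exact ⟨Finset.sum_eq_zero fun i _ => mul_zero _,
              Finset.sum_eq_zero fun i _ => mul_zero _⟩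
        exact ((Einner_eq_zero _ _).1 (hR _ hm)).2
    have hb : (fun i => Prod.snd (x i)) ∈ Tor C := by
      apply mem_of_dual
      · exact hC.1
      · intro y hy z hz
        have e : zetaVec y + zetaVec z = zetaVec (y + z) := by
          funext i
          show Prod.mk ((0 : ZMod 2) + 0) (y i + z i) = Prod.mk (0 : ZMod 2) (y i + z i)
          simp
        show zetaVec (y + z) ∈ C
        rw [← e]
        exact hC.2.1 _ hy _ hz
      · intro c hc
        have hm : kappaVec c ∈ dualE C := by
          constructor
          · intro w hw
            rw [Einner_eq_zero]
            exact ⟨hc _ (zetaVec_mem hC hw), Finset.sum_eq_zero fun i _ => zero_mul _⟩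
          · intro w hw
            rw [Einner_eq_zero]
            have h1 := hc _ (zetaVec_mem hC hw)
            have h2 := hc _ (zetaVec_snd_mem hC hw)
            constructor
            · rw [← h1]
              exact Finset.sum_congr rfl fun i _ => mul_comm _ _
            · rw [← h2]
              exact Finset.sum_congr rfl fun i _ => mul_comm _ _
        have h := ((Einner_eq_zero _ _).1 (hL _ hm)).2
        rw [← h]
        exact Finset.sum_congr rfl fun i _ => mul_comm _ _
    obtain ⟨y, hy, hyx⟩ := ha
    rw [← decomp x, ← hyx]
    exact hC.2.1 _ (kappaVec_mem hC hy) _ hb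
  · intro x hx
    exact ⟨fun z hz => hz.2 x hx, fun z hz => hz.1 x hx⟩
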